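/- Chernoff's theorem: Let X be a Banach space, L a closed densely defined operator generating a C₀-semigroup (e^{tL})_{t≥0} on X, and G : [0,∞) → B(X) a strongly continuous family of bounded operators with G(0) = I, ‖G(t)‖ ≤ e^{ωt} for some ω ∈ ℝ and all t ≥ 0, such that for all f in a dense subspace D, lim_{t→0⁺}(G(t)f − f)/t = Lf, and the closure of L restricted to D equals L. Then for every f ∈ X and T > 0, sup_{t∈[0,T]} ‖e^{tL}f − G(t/n)^n f‖ → 0 as n → ∞. -/

import Mathlib

open Filter
open scoped Topology

section ChernoffHelpers

variable {X : Type*} [NormedAddCommGroup X] [NormedSpace ℝ X]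

/-- `y` is the value of the generator of the family `T` at `x`. -/
def ChGen (T : ℝ → X →L[ℝ] X) (x y : X) : Prop :=
  Tendsto (fun t : ℝ => t⁻¹ • (T t x - x)) (𝓝[>] 0) (𝓝 y)

theorem ChGen.sub {T : ℝ → X →L[ℝ] X} {x y x' y' : X} (h : ChGen T x y) (h' : ChGen T x' y') :
    ChGen T (x - x') (y - y') := by
  refine (Tendsto.sub h h').congr fun t => ?_
  rw [map_sub, ← smul_sub]
  congr 1
  abel

theorem ChGen.smul {T : ℝ → X →L[ℝ] X} {x y : X} (c : ℝ) (h : ChGen T x y) :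
    ChGen T (c • x) (c • y) := by
  refine (Tendsto.const_smul h c).congr fun t => ?_
  rw [map_smul, ← smul_sub, smul_comm]

theorem ch_comm {T : ℝ → X →L[ℝ] X}
    (hTadd : ∀ s t : ℝ, 0 ≤ s → 0 ≤ t → T (s + t) = (T s).comp (T t))
    {s t : ℝ} (hs : 0 ≤ s) (ht : 0 ≤ t) (x : X) : T s (T t x) = T t (T s x) := by
  have h1 := hTadd s t hs ht
  have h2 := hTadd t s ht hs
  rw [add_comm, h1] at h2
  exact congrArg (fun A : X →L[ℝ] X => A x) h2

theorem ChGen.map {T : ℝ → X →L[ℝ] X}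
    (hTadd : ∀ s t : ℝ, 0 ≤ s → 0 ≤ t → T (s + t) = (T s).comp (T t))
    {x y : X} (h : ChGen T x y) {s : ℝ} (hs : 0 ≤ s) :
    ChGen T (T s x) (T s y) := by
  have := ((T s).continuous.tendsto y).comp h
  refine this.congr' ?_
  filter_upwards [self_mem_nhdsWithin] with t ht
  have ht : 0 < t := ht
  simp only [Function.comp, map_smul, map_sub]
  rw [ch_comm hTadd hs ht.le]

/-- Equibounded pointwise convergence along a continuous curve is uniform on compacts. -/
theorem ch_unif (R : ℝ → X →L[ℝ] X) (hR : ∀ᶠ h in 𝓝[>] (0:ℝ), ‖R h‖ ≤ 1)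
    (p q : ℝ → X) (K : Set ℝ) (hK : IsCompact K) (hp : ContinuousOn p K) (hq : ContinuousOn q K)
    (hpq : ∀ s ∈ K, Tendsto (fun h => R h (p s)) (𝓝[>] 0) (𝓝 (q s))) (ε : ℝ) (hε : 0 < ε) :
    ∀ᶠ h in 𝓝[>] (0:ℝ), ∀ s ∈ K, ‖R h (p s) - q s‖ ≤ ε := by
  have key : TendstoLocallyUniformlyOn (fun h s => R h (p s)) q (𝓝[>] (0:ℝ)) K := by
    rw [Metric.tendstoLocallyUniformlyOn_iff]
    intro e he s hs
    refine ⟨K ∩ {s' | ‖p s' - p s‖ < e / 3 ∧ ‖q s' - q s‖ < e / 3}, ?_, ?_⟩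
    · have h1 := Metric.tendsto_nhds.1 (hp s hs) (e / 3) (by positivity)
      have h2 := Metric.tendsto_nhds.1 (hq s hs) (e / 3) (by positivity)
      filter_upwards [h1, h2, self_mem_nhdsWithin] with s' a b c
      rw [dist_eq_norm] at a b
      exact ⟨c, a, b⟩
    · have h3 := Metric.tendsto_nhds.1 (hpq s hs) (e / 3) (by positivity)
      filter_upwards [h3, hR] with h a b s' hs'
      rw [dist_eq_norm] at a
      have hs'1 := hs'.2.1
      have hs'2 := hs'.2.2
      have h4 : ‖R h (p s' - p s)‖ ≤ ‖p s' - p s‖ := by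
        refine ((R h).le_opNorm _).trans ?_
        nlinarith [norm_nonneg (p s' - p s)]
      have h5 : q s' - R h (p s') = (q s' - q s) - (R h (p s) - q s) - R h (p s' - p s) := by
        rw [map_sub]; abel
      rw [dist_eq_norm, h5]
      have h6 := norm_sub_le ((q s' - q s) - (R h (p s) - q s)) (R h (p s' - p s))
      have h7 := norm_sub_le (q s' - q s) (R h (p s) - q s)
      linarith
  have := (tendstoLocallyUniformlyOn_iff_tendstoUniformlyOn_of_compact hK).1 key
  rw [Metric.tendstoUniformlyOn_iff] at this
  filter_upwards [this ε hε] with h hh s hs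
  have := hh s hs
  rw [dist_comm, dist_eq_norm] at this
  exact this.le

theorem ch_resolvent [CompleteSpace X] (G : X →L[ℝ] X) (c h : ℝ) (hh : 0 < h) (hc : 0 < c)
    (hG : ‖G‖ + h ≤ c) :
    ∃ R : X →L[ℝ] X, ‖R‖ ≤ 1 ∧ (∀ x, R (c • x - G x) = h • x) ∧ ∀ x, G (R x) = R (G x) := by
  have hlt : ‖c⁻¹ • G‖ < 1 := by
    rw [norm_smul, Real.norm_eq_abs, abs_of_pos (inv_pos.2 hc), inv_mul_lt_iff₀ hc]
    linarith
  let U := Units.oneSub (c⁻¹ • G) hlt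
  have hU : (U : X →L[ℝ] X) = 1 - c⁻¹ • G := rfl
  have hUx : ∀ x, c • (U : X →L[ℝ] X) x = c • x - G x := by
    intro x
    rw [hU]
    simp [smul_sub, smul_smul, hc.ne']
  let V : X →L[ℝ] X := ((U⁻¹ : (X →L[ℝ] X)ˣ) : X →L[ℝ] X)
  have hVU : ∀ x, V ((U : X →L[ℝ] X) x) = x := fun x =>
    congrArg (fun A : X →L[ℝ] X => A x) U.inv_mul
  have hUV : ∀ x, (U : X →L[ℝ] X) (V x) = x := fun x =>
    congrArg (fun A : X →L[ℝ] X => A x) U.mul_inv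
  have hVcx : ∀ x, V (c • x - G x) = c • x := by
    intro x
    rw [← hUx, map_smul, hVU]
  have hcxV : ∀ x, c • V x - G (V x) = c • x := by
    intro x
    rw [← hUx, hUV]
  refine ⟨(h * c⁻¹) • V, ?_, ?_, ?_⟩
  · refine ContinuousLinearMap.opNorm_le_bound _ zero_le_one fun x => ?_
    rw [smul_apply, norm_smul, Real.norm_eq_abs,
      abs_of_pos (by positivity), one_mul]
    have h1 := hcxV x
    have h2 : c * ‖V x‖ ≤ c * ‖x‖ + ‖G‖ * ‖V x‖ := by
      have h3 : c • V x = c • x + G (V x) := by rw [← h1]; abel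
      have h4 : ‖c • V x‖ ≤ ‖c • x‖ + ‖G (V x)‖ := by rw [h3]; exact norm_add_le _ _
      rw [norm_smul, norm_smul, Real.norm_eq_abs, abs_of_pos hc] at h4
      linarith [G.le_opNorm (V x)]
    have h5 : h * ‖V x‖ ≤ c * ‖x‖ := by nlinarith [norm_nonneg (V x)]
    calc h * c⁻¹ * ‖V x‖ = c⁻¹ * (h * ‖V x‖) := by ring
      _ ≤ c⁻¹ * (c * ‖x‖) := by gcongr
      _ = ‖x‖ := by field_simp
  · intro x
    rw [smul_apply, hVcx, smul_smul]
    congr 1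
    field_simp
  · intro x
    simp only [smul_apply, map_smul]
    congr 1
    have h1 := hVcx x
    have h2 := hcxV x
    rw [map_sub, map_smul] at h1
    have h3 := h2.trans h1.symm
    exact sub_right_injective h3

/-- Mollification. -/
theorem ch_mollify [CompleteSpace X] {T : ℝ → X →L[ℝ] X}
    (hT0 : T 0 = ContinuousLinearMap.id ℝ X)
    (hTadd : ∀ s t : ℝ, 0 ≤ s → 0 ≤ t → T (s + t) = (T s).comp (T t))
    (hTcont : ∀ x : X, ContinuousOn (fun t => T t x) (Set.Ici 0)) (x : X) :
    ∃ Φ : ℝ → X, Tendsto (fun a => a⁻¹ • Φ a) (𝓝[>] 0) (𝓝 x) ∧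
      ∀ a, 0 ≤ a → ChGen T (Φ a) (T a x - x) := by
  let g : ℝ → X := fun s => T (max s 0) x
  have hg : Continuous g := by
    have : Continuous fun s : ℝ => max s 0 := by fun_prop
    exact (hTcont x).comp_continuous this fun s => Set.mem_Ici.2 (le_max_right _ _)
  have hg0 : g 0 = x := by simp [g, hT0]
  let Φ : ℝ → X := fun t => ∫ s in (0:ℝ)..t, g s
  have hΦ0 : Φ 0 = 0 := by simp [Φ]
  have hd : ∀ a, HasDerivAt Φ (g a) a := fun a =>
    intervalIntegral.integral_hasDerivAt_right (hg.intervalIntegrable _ _)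
      (hg.stronglyMeasurableAtFilter _ _) hg.continuousAt
  have hlim : ∀ a, Tendsto (fun t => t⁻¹ • (Φ (a + t) - Φ a)) (𝓝[>] 0) (𝓝 (g a)) := by
    intro a
    exact (hasDerivAt_iff_tendsto_slope_zero.1 (hd a)).mono_left
      (nhdsWithin_mono _ fun t ht => ne_of_gt ht)
  refine ⟨Φ, ?_, ?_⟩
  · have := hlim 0
    simpa [hΦ0, hg0] using this
  · intro a ha
    have h1 := (hlim a).sub (hlim 0)
    have hga : g a = T a x := by simp [g, ha]
    rw [hg0, hga] at h1
    refine h1.congr' ?_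
    filter_upwards [self_mem_nhdsWithin] with t ht
    have ht : 0 < t := ht
    have h2 : T t (Φ a) = Φ (a + t) - Φ t := by
      have e1 : T t (Φ a) = ∫ s in (0:ℝ)..a, T t (g s) :=
        ((T t).intervalIntegral_comp_comm (hg.intervalIntegrable _ _)).symm
      have e2 : ∫ s in (0:ℝ)..a, T t (g s) = ∫ s in (0:ℝ)..a, g (s + t) := by
        refine intervalIntegral.integral_congr fun s hs => ?_
        rw [Set.uIcc_of_le ha] at hs
        simp only [g]
        rw [max_eq_left hs.1, max_eq_left (by linarith [hs.1]), add_comm, hTadd t s ht.le hs.1]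
        rfl
      rw [e1, e2, intervalIntegral.integral_comp_add_right, zero_add]
      exact (intervalIntegral.integral_interval_sub_left (hg.intervalIntegrable _ _)
        (hg.intervalIntegrable _ _)).symm
    rw [h2, ← smul_sub, zero_add, hΦ0]
    congr 1
    abel

theorem ch_bound [CompleteSpace X] {T : ℝ → X →L[ℝ] X}
    (hTcont : ∀ x : X, ContinuousOn (fun t => T t x) (Set.Ici 0)) (b : ℝ) :
    ∃ M : ℝ, 0 ≤ M ∧ ∀ s ∈ Set.Icc (0:ℝ) b, ‖T s‖ ≤ M := by
  have := banach_steinhaus (g := fun s : Set.Icc (0:ℝ) b => T s) (by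
    intro x
    obtain ⟨C, hC⟩ := (isCompact_Icc (a := (0:ℝ)) (b := b)).exists_bound_of_continuousOn
      ((hTcont x).mono Set.Icc_subset_Ici_self)
    exact ⟨C, fun i => hC i i.2⟩)
  obtain ⟨C, hC⟩ := this
  exact ⟨max C 0, le_max_right _ _, fun s hs => (hC ⟨s, hs⟩).trans (le_max_left _ _)⟩

/-- One-step error. -/
theorem ch_step {T : ℝ → X →L[ℝ] X}
    (hTadd : ∀ s t : ℝ, 0 ≤ s → 0 ≤ t → T (s + t) = (T s).comp (T t))
    (G R : X →L[ℝ] X) (l h s : ℝ) (hh : 0 < h) (hs : 0 ≤ s)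
    (hR1 : ‖R‖ ≤ 1) (hR : ∀ x, R ((1 + l * h) • x - G x) = h • x) (hGR : ∀ x, G (R x) = R (G x))
    (u z : X) (M η : ℝ) (hM : ‖T s‖ ≤ M) (hη : ‖R (T s (l • u - z)) - T s u‖ ≤ η)
    (hd : ‖h⁻¹ • (T h u - u) - z‖ ≤ η) :
    ‖G (R (T s u)) - R (T h (T s u))‖ ≤ h * (η + M * η) := by
  set d := h⁻¹ • (T h u - u) - z with hdd
  have e1 : T h u = u + h • z + h • d := by
    rw [hdd, smul_sub, smul_inv_smul₀ hh.ne']; abel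
  have e2 : T h (T s u) = T s u + h • T s z + h • T s d := by
    rw [ch_comm hTadd hh.le hs, e1]; simp
  have e3 : R (G (T s u)) = (1 + l * h) • R (T s u) - h • T s u := by
    rw [← hR (T s u)]; simp
  have e4 : G (R (T s u)) - R (T h (T s u))
      = h • ((R (T s (l • u - z)) - T s u) - R (T s d)) := by
    rw [hGR, e3, e2]
    simp only [map_add, map_sub, map_smul]
    module
  rw [e4, norm_smul, Real.norm_eq_abs, abs_of_pos hh]
  have h1 : ‖R (T s d)‖ ≤ M * η := by
    have a1 := R.le_opNorm (T s d)
    have a2 := (T s).le_opNorm d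
    have a3 : ‖T s‖ * ‖d‖ ≤ M * η := by
      have := norm_nonneg (T s)
      gcongr
      linarith
    nlinarith [norm_nonneg (T s d)]
  have h2 := norm_sub_le (R (T s (l • u - z)) - T s u) (R (T s d))
  gcongr
  linarith

/-- Telescoping. -/
theorem ch_tele {T : ℝ → X →L[ℝ] X}
    (hT0 : T 0 = ContinuousLinearMap.id ℝ X)
    (hTadd : ∀ s t : ℝ, 0 ≤ s → 0 ≤ t → T (s + t) = (T s).comp (T t))
    (G R : X →L[ℝ] X) (h a κ b : ℝ) (hh : 0 < h) (ha : 1 ≤ a) (hκ : 0 ≤ κ) (hG : ‖G‖ ≤ a) (u : X)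
    (hstep : ∀ s ∈ Set.Icc (0:ℝ) b, ‖G (R (T s u)) - R (T h (T s u))‖ ≤ h * κ) (n : ℕ)
    (hn : n * h ≤ b) :
    ‖(G ^ n) (R u) - R (T (n * h) u)‖ ≤ n * (h * κ) * a ^ n := by
  induction n with
  | zero => simp [hT0]
  | succ n ih =>
    rw [Nat.cast_succ] at hn ⊢
    have hnh : (0:ℝ) ≤ n * h := by positivity
    have h1 := ih (by nlinarith)
    have h2 := hstep (n * h) ⟨hnh, by nlinarith⟩
    have e1 : T ((n + 1) * h) u = T h (T (n * h) u) := by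
      rw [show ((n:ℝ) + 1) * h = h + n * h by ring, hTadd h _ hh.le hnh]; rfl
    have e2 : (G ^ (n + 1)) (R u) - R (T ((n + 1) * h) u)
        = G ((G ^ n) (R u) - R (T (n * h) u))
          + (G (R (T (n * h) u)) - R (T h (T (n * h) u))) := by
      rw [e1, pow_succ', map_sub]
      simp
    rw [e2]
    refine (norm_add_le _ _).trans ?_
    have h3 : ‖G ((G ^ n) (R u) - R (T (n * h) u))‖ ≤ a * (n * (h * κ) * a ^ n) := by
      refine (G.le_opNorm _).trans ?_
      gcongr
    have h4 : 1 ≤ a ^ (n + 1) := one_le_pow₀ ha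
    have h5 : h * κ * 1 ≤ h * κ * a ^ (n + 1) := by gcongr
    calc _ ≤ a * (n * (h * κ) * a ^ n) + h * κ * a ^ (n + 1) := by linarith
      _ = _ := by ring

end ChernoffHelpers

/-- Chernoff's theorem: if L (closed, densely defined) generates
a C₀-semigroup (T t), and G is a strongly continuous family with G 0 = I,
‖G t‖ ≤ e^{ωt}, Chernoff-tangent to L on a dense subspace D whose graph-closure
recovers L, then G(t/n)^n f → T t f uniformly on compact time intervals. -/
theorem stmt19 {X : Type*} [NormedAddCommGroup X] [NormedSpace ℝ X]
    [CompleteSpace X]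
    (DomL : Submodule ℝ X) (hDomL : Dense (DomL : Set X)) (L : DomL →ₗ[ℝ] X)
    (hclosed : IsClosed {p : X × X | ∃ x : DomL, p = ((x : X), L x)})
    (T : ℝ → X →L[ℝ] X)
    (hT0 : T 0 = ContinuousLinearMap.id ℝ X)
    (hTadd : ∀ s t : ℝ, 0 ≤ s → 0 ≤ t → T (s + t) = (T s).comp (T t))
    (hTcont : ∀ x : X, ContinuousOn (fun t => T t x) (Set.Ici 0))
    (hgen : ∀ x y : X,
      Tendsto (fun t : ℝ => t⁻¹ • (T t x - x)) (nhdsWithin 0 (Set.Ioi 0))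
          (nhds y)
        ↔ ∃ hx : x ∈ DomL, L ⟨x, hx⟩ = y)
    (G : ℝ → X →L[ℝ] X)
    (hG0 : G 0 = ContinuousLinearMap.id ℝ X)
    (hGcont : ∀ x : X, ContinuousOn (fun t => G t x) (Set.Ici 0))
    (ω : ℝ) (hGnorm : ∀ t : ℝ, 0 ≤ t → ‖G t‖ ≤ Real.exp (ω * t))
    (D : Submodule ℝ X) (hDdense : Dense (D : Set X)) (hDsub : D ≤ DomL)
    (htangent : ∀ (x : X) (hx : x ∈ D),
      Tendsto (fun t : ℝ => t⁻¹ • (G t x - x)) (nhdsWithin 0 (Set.Ioi 0))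
        (nhds (L ⟨x, hDsub hx⟩)))
    (hcore : closure {p : X × X | ∃ (x : X) (hx : x ∈ D),
          p = (x, L ⟨x, hDsub hx⟩)}
        = {p : X × X | ∃ x : DomL, p = ((x : X), L x)}) :
    ∀ (f : X) (Tmax : ℝ), 0 < Tmax → ∀ ε > 0, ∃ N : ℕ, ∀ n ≥ N,
      ∀ t ∈ Set.Icc (0 : ℝ) Tmax, ‖T t f - ((G (t / n)) ^ n) f‖ ≤ ε := by
  intro f Tmax hTmax ε hε
  -- replace ω by w ≥ 0
  obtain ⟨w, hw0, hGw⟩ : ∃ w : ℝ, 0 ≤ w ∧ ∀ t : ℝ, 0 ≤ t → ‖G t‖ ≤ Real.exp (w * t) :=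
    ⟨|ω|, abs_nonneg _, fun t ht => (hGnorm t ht).trans
      (Real.exp_le_exp.2 (mul_le_mul_of_nonneg_right (le_abs_self ω) ht))⟩
  set l : ℝ := 2 * w + 1 with hl
  -- approximate resolvents
  have hres : ∀ h : ℝ, ∃ R : X →L[ℝ] X, (0 < h ∧ w * h ≤ 1 / 2) → (‖R‖ ≤ 1 ∧
      (∀ x, R ((1 + l * h) • x - G h x) = h • x) ∧ ∀ x, G h (R x) = R (G h x)) := by
    intro h
    by_cases hh : 0 < h ∧ w * h ≤ 1 / 2
    · obtain ⟨hh, hwh⟩ := hh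
      have hwh0 : 0 ≤ w * h := by positivity
      have hexp : Real.exp (w * h) ≤ 1 + 2 * (w * h) := by
        have h1 := Real.add_one_le_exp (-(w * h))
        rw [Real.exp_neg] at h1
        have h2 := Real.exp_pos (w * h)
        have h3 : (-(w * h) + 1) * Real.exp (w * h) ≤ 1 := by
          calc _ ≤ (Real.exp (w * h))⁻¹ * Real.exp (w * h) := by gcongr
            _ = 1 := inv_mul_cancel₀ h2.ne'
        nlinarith
      obtain ⟨R, hR⟩ := ch_resolvent (G h) (1 + l * h) h hh (by rw [hl]; positivity)
        (by have := hGw h hh.le; rw [hl]; linarith)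
      exact ⟨R, fun _ => hR⟩
    · exact ⟨0, fun h' => absurd h' hh⟩
  choose R hR using hres
  have hsmall : ∀ᶠ h in 𝓝[>] (0:ℝ), 0 < h ∧ w * h ≤ 1 / 2 := by
    have h1 : Tendsto (fun h : ℝ => w * h) (𝓝[>] 0) (𝓝 0) := by
      have : Continuous fun h : ℝ => w * h := by fun_prop
      simpa using (this.tendsto 0).mono_left nhdsWithin_le_nhds
    filter_upwards [self_mem_nhdsWithin, h1.eventually_le_const (show (0:ℝ) < 1 / 2 by norm_num)]
      with h a b
    exact ⟨a, b⟩
  have hRb : ∀ᶠ h in 𝓝[>] (0:ℝ), ‖R h‖ ≤ 1 := hsmall.mono fun h hh => (hR h hh).1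
  -- convergence of the resolvents
  have hA : ∀ v z : X, ChGen T v z → Tendsto (fun h => R h (l • v - z)) (𝓝[>] 0) (𝓝 v) := by
    intro v z hvz
    obtain ⟨hv, hLv⟩ := (hgen v z).1 hvz
    have hmem : (v, z) ∈ closure {p : X × X | ∃ (x : X) (hx : x ∈ D),
          p = (x, L ⟨x, hDsub hx⟩)} := by
      rw [hcore]
      exact ⟨⟨v, hv⟩, by rw [hLv]⟩
    rw [Metric.tendsto_nhds]
    intro e he
    have hl0 : 0 < l := by rw [hl]; positivity
    obtain ⟨p, ⟨x, hx, rfl⟩, hp⟩ := Metric.mem_closure_iff.1 hmem (e / (4 * (l + 1)))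
      (by positivity)
    rw [Prod.dist_eq, max_lt_iff, dist_eq_norm, dist_eq_norm] at hp
    obtain ⟨hp1, hp2⟩ := hp
    simp only at hp1 hp2
    set y := L ⟨x, hDsub hx⟩ with hy
    have ht := Metric.tendsto_nhds.1 (htangent x hx) (e / 4) (by positivity)
    filter_upwards [ht, hsmall] with h h1 h2
    obtain ⟨hRn, hRi, -⟩ := hR h h2
    rw [dist_eq_norm] at h1 ⊢
    have hle : ∀ q, ‖R h q‖ ≤ ‖q‖ := fun q => by
      refine ((R h).le_opNorm q).trans ?_
      nlinarith [norm_nonneg q]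
    have e1 : R h (l • x - h⁻¹ • (G h x - x)) = x := by
      have : l • x - h⁻¹ • (G h x - x) = h⁻¹ • ((1 + l * h) • x - G h x) := by
        have e0 : h⁻¹ • ((l * h) • x) = l • x := by
          rw [smul_smul]; congr 1; field_simp [h2.1.ne']
        rw [add_smul 1 (l * h), one_smul, smul_sub, smul_sub, smul_add, e0]; abel
      rw [this, map_smul, hRi, inv_smul_smul₀ h2.1.ne']
    have e2 : R h (l • v - z) - v
        = R h (l • (v - x) - (z - y)) + R h (h⁻¹ • (G h x - x) - y) - (v - x) := by
      have e3 : l • v - z = (l • (v - x) - (z - y)) + (h⁻¹ • (G h x - x) - y)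
          + (l • x - h⁻¹ • (G h x - x)) := by
        rw [smul_sub]; abel
      rw [e3, map_add, map_add, e1]; abel
    rw [e2]
    have n1 := norm_sub_le (R h (l • (v - x) - (z - y)) + R h (h⁻¹ • (G h x - x) - y)) (v - x)
    have n2 := norm_add_le (R h (l • (v - x) - (z - y))) (R h (h⁻¹ • (G h x - x) - y))
    have n3 := hle (l • (v - x) - (z - y))
    have n4 := hle (h⁻¹ • (G h x - x) - y)
    have n5 := norm_sub_le (l • (v - x)) (z - y)
    rw [norm_smul, Real.norm_eq_abs, abs_of_pos hl0] at n5
    have n6 : l * ‖v - x‖ ≤ l * (e / (4 * (l + 1))) := by gcongr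
    have n7 : (l + 1) * (e / (4 * (l + 1))) = e / 4 := by field_simp
    have n8 : e / (4 * (l + 1)) ≤ e / 4 := by
      gcongr; linarith
    linarith
  obtain ⟨M, hM0, hM⟩ := ch_bound hTcont Tmax
  set K : ℝ := Real.exp (w * Tmax) with hK
  have hK1 : 1 ≤ K := Real.one_le_exp (by positivity)
  have hpow : ∀ h : ℝ, 0 ≤ h → ∀ n : ℕ, n * h ≤ Tmax → Real.exp (w * h) ^ n ≤ K := by
    intro h hh n hn
    rw [← Real.exp_nat_mul, hK]
    apply Real.exp_le_exp.2
    calc (n:ℝ) * (w * h) = w * (n * h) := by ring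
      _ ≤ w * Tmax := by gcongr
  have hGpow : ∀ h : ℝ, 0 ≤ h → ∀ n : ℕ, n * h ≤ Tmax → ∀ x, ‖(G h ^ n) x‖ ≤ K * ‖x‖ := by
    intro h hh n hn x
    have h1 : ∀ m : ℕ, ‖(G h ^ m) x‖ ≤ Real.exp (w * h) ^ m * ‖x‖ := by
      intro m
      induction m with
      | zero => simp
      | succ m ih =>
        have : (G h ^ (m + 1)) x = G h ((G h ^ m) x) := by rw [pow_succ']; rfl
        rw [this, pow_succ', mul_assoc]
        refine ((G h).le_opNorm _).trans ?_
        have := hGw h hh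
        gcongr
    refine (h1 n).trans ?_
    have := hpow h hh n hn
    gcongr
  -- convergence for v in the domain of the square
  have hmain : ∀ v z z' : X, ChGen T v z → ChGen T (l • v - z) z' → ∀ e > 0,
      ∀ᶠ h in 𝓝[>] (0:ℝ), ∀ n : ℕ, n * h ≤ Tmax → ‖T (n * h) v - (G h ^ n) v‖ ≤ e := by
    intro v z z' hv hu e he
    set u := l • v - z with hu_def
    set η : ℝ := e / (2 * (K + 1 + Tmax * (1 + M) * K)) with hη
    have hη0 : 0 < η := by positivity
    have u1 := ch_unif R hRb (fun s => T s u) (fun s => T s v) (Set.Icc 0 Tmax) isCompact_Icc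
      ((hTcont u).mono Set.Icc_subset_Ici_self) ((hTcont v).mono Set.Icc_subset_Ici_self)
      (fun s hs => by
        have := hA _ _ (hv.map hTadd hs.1)
        simpa [hu_def] using this) η hη0
    have u2 := ch_unif R hRb (fun s => T s (l • u - z')) (fun s => T s u) (Set.Icc 0 Tmax)
      isCompact_Icc
      ((hTcont _).mono Set.Icc_subset_Ici_self) ((hTcont u).mono Set.Icc_subset_Ici_self)
      (fun s hs => by
        have := hA _ _ (hu.map hTadd hs.1)
        simpa only [map_sub, map_smul] using this) η hη0
    have u3 := Metric.tendsto_nhds.1 hu η hη0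
    filter_upwards [u1, u2, u3, hsmall] with h a1 a2 a3 hh n hn
    rw [dist_eq_norm] at a3
    obtain ⟨hRn, hRi, hRc⟩ := hR h hh
    have hnh : (n * h : ℝ) ∈ Set.Icc (0:ℝ) Tmax := ⟨by have := hh.1; positivity, hn⟩
    have t1 := ch_tele hT0 hTadd (G h) (R h) h (Real.exp (w * h)) (η + M * η) Tmax hh.1
      (Real.one_le_exp (by have := hh.1; positivity)) (by positivity) (hGw h hh.1.le) u
      (fun s hs => ch_step hTadd (G h) (R h) l h s hh.1 hs.1 hRn hRi hRc u z' M η (hM s hs)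
        (a2 s hs) a3.le) n hn
    have t2 : (n:ℝ) * (h * (η + M * η)) * Real.exp (w * h) ^ n ≤ Tmax * (1 + M) * K * η := by
      have := hpow h hh.1.le n hn
      calc (n:ℝ) * (h * (η + M * η)) * Real.exp (w * h) ^ n
          = (n * h) * ((1 + M) * η) * Real.exp (w * h) ^ n := by ring
        _ ≤ Tmax * ((1 + M) * η) * K := by gcongr
        _ = _ := by ring
    have t3 := a1 (n * h) hnh
    have t4 : ‖R h u - v‖ ≤ η := by
      have := a1 0 ⟨le_refl _, hTmax.le⟩
      simpa [hT0] using this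
    have t5 := hGpow h hh.1.le n hn (R h u - v)
    have t6 : K * ‖R h u - v‖ ≤ K * η := by gcongr
    have e1 : T (n * h) v - (G h ^ n) v = (G h ^ n) (R h u - v)
        - ((G h ^ n) (R h u) - R h (T (n * h) u)) - (R h (T (n * h) u) - T (n * h) v) := by
      rw [map_sub]; abel
    rw [e1]
    have n1 := norm_sub_le ((G h ^ n) (R h u - v) - ((G h ^ n) (R h u) - R h (T (n * h) u)))
      (R h (T (n * h) u) - T (n * h) v)
    have n2 := norm_sub_le ((G h ^ n) (R h u - v)) ((G h ^ n) (R h u) - R h (T (n * h) u))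
    have n3 : (K + 1 + Tmax * (1 + M) * K) * η = e / 2 := by
      rw [hη]; field_simp
    nlinarith
  -- choose a good approximation of f
  set δ : ℝ := ε / (2 * (M + K)) with hδ
  have hδ0 : 0 < δ := by positivity
  obtain ⟨v, z, z', hv, hu, hvf⟩ : ∃ v z z' : X, ChGen T v z ∧ ChGen T (l • v - z) z' ∧
      ‖f - v‖ < δ := by
    obtain ⟨x, hx, hfx⟩ := Metric.mem_closure_iff.1 (hDomL f) (δ / 2) (by positivity)
    have hxg : ChGen T x (L ⟨x, hx⟩) := (hgen x _).2 ⟨hx, rfl⟩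
    obtain ⟨Φ, hΦ, hΦg⟩ := ch_mollify hT0 hTadd hTcont x
    have h1 := Metric.tendsto_nhds.1 hΦ (δ / 2) (by positivity)
    obtain ⟨a, ha1, ha2⟩ := (h1.and self_mem_nhdsWithin).exists
    have ha2 : 0 < a := ha2
    have g1 := (hΦg a ha2.le).smul a⁻¹
    have g2 := ((hxg.map hTadd ha2.le).sub hxg).smul a⁻¹
    refine ⟨a⁻¹ • Φ a, _, _, g1, (g1.smul l).sub g2, ?_⟩
    rw [← dist_eq_norm]
    calc _ ≤ dist f x + dist x (a⁻¹ • Φ a) := dist_triangle _ _ _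
      _ < δ := by rw [dist_comm x]; linarith
  have hev := hmain v z z' hv hu (ε / 2) (by positivity)
  obtain ⟨b, hb, hbs⟩ := mem_nhdsGT_iff_exists_Ioo_subset.1 hev
  have hb : 0 < b := hb
  obtain ⟨N, hN⟩ := exists_nat_gt (Tmax / b)
  refine ⟨N + 1, fun n hn t ht => ?_⟩
  have hn0 : (0:ℝ) < n := by
    have : 0 < n := by omega
    exact_mod_cast this
  rcases ht.1.eq_or_lt with h0 | h0
  · subst h0
    simp [hT0, hG0, ← ContinuousLinearMap.one_def]
    exact hε.le
  have hnt : (n:ℝ) * (t / n) = t := by field_simp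
  have hlt : t / n < b := by
    rw [div_lt_iff₀ hn0]
    rw [div_lt_iff₀ hb] at hN
    have : (N:ℝ) ≤ n := by exact_mod_cast (by omega : N ≤ n)
    nlinarith [ht.2]
  have hfin := hbs ⟨div_pos h0 hn0, hlt⟩ n (by rw [hnt]; exact ht.2)
  rw [hnt] at hfin
  have q1 := hGpow (t / n) (by positivity) n (by rw [hnt]; exact ht.2) (f - v)
  have q2 : ‖T t (f - v)‖ ≤ M * ‖f - v‖ := by
    refine ((T t).le_opNorm _).trans ?_
    have := hM t ht
    gcongr
  have e1 : T t f - (G (t / n) ^ n) f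
      = T t (f - v) + (T t v - (G (t / n) ^ n) v) - (G (t / n) ^ n) (f - v) := by
    rw [map_sub, map_sub]; abel
  rw [e1]
  have n1 := norm_sub_le (T t (f - v) + (T t v - (G (t / n) ^ n) v)) ((G (t / n) ^ n) (f - v))
  have n2 := norm_add_le (T t (f - v)) (T t v - (G (t / n) ^ n) v)
  have n3 : (M + K) * ‖f - v‖ ≤ (M + K) * δ := by gcongr
  have n4 : (M + K) * δ = ε / 2 := by rw [hδ]; field_simp
  nlinarith
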